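/- Let k be a natural number and let D be an oriented graph with minimum pseudo-semidegree at least (3k-2)/4. If the maximum length m of an antidirected path in D satisfies 1 < m < k, then D contains an antidirected cycle of length m + 1. -/

import Mathlib

/-- Out-degree of `v` in the digraph given by the edge relation `D`. -/
noncomputable def outDeg {V : Type*} (D : V → V → Prop) (v : V) : ℕ := {w | D v w}.ncard

/-- In-degree of `v` in the digraph given by the edge relation `D`. -/
noncomputable def inDeg {V : Type*} (D : V → V → Prop) (v : V) : ℕ := {w | D w v}.ncard

/-- `D` is an oriented graph: for each pair of vertices, at most one of the edges
`uv`, `vu` is present (in particular there are no loops). -/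
def IsOriented {V : Type*} (D : V → V → Prop) : Prop := ∀ u v, D u v → ¬ D v u

/-- The number of (directed) edges of the digraph `D`. -/
noncomputable def edgeCount {V : Type*} (D : V → V → Prop) : ℕ := {p : V × V | D p.1 p.2}.ncard

/-- The minimum pseudo-semidegree of `D` is at least `x`: `D` has an edge, and every
vertex has out-degree `0` or at least `x`, and in-degree `0` or at least `x`. -/
def PseudoGE {V : Type*} (D : V → V → Prop) (x : ℝ) : Prop :=
  (∃ u v, D u v) ∧
    ∀ v, (outDeg D v = 0 ∨ x ≤ (outDeg D v : ℝ)) ∧ (inDeg D v = 0 ∨ x ≤ (inDeg D v : ℝ))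

/-- The minimum pseudo-semidegree of `D` is strictly greater than `x`. -/
def PseudoGT {V : Type*} (D : V → V → Prop) (x : ℝ) : Prop :=
  (∃ u v, D u v) ∧
    ∀ v, (outDeg D v = 0 ∨ x < (outDeg D v : ℝ)) ∧ (inDeg D v = 0 ∨ x < (inDeg D v : ℝ))

/-- `f, g` describe an antidirected path `f 0, f 1, ..., f m` (of length `m`) in `D`:
`g i = true` iff the `i`-th edge is directed from `f i` towards `f (i+1)`, and consecutive
edges alternate in direction (equivalently, every vertex of the path has out-degree `0`
or in-degree `0` on the path). -/
def IsAntipath {V : Type*} (D : V → V → Prop) (m : ℕ) (f : ℕ → V) (g : ℕ → Bool) : Prop :=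
  Set.InjOn f (Set.Iic m) ∧
  (∀ i < m, if g i then D (f i) (f (i + 1)) else D (f (i + 1)) (f i)) ∧
  (∀ i, i + 1 < m → g i ≠ g (i + 1))

/-- `D` contains each of the (at most two) antidirected paths of length `k`:
for each initial direction `b` there is an antidirected path of length `k`
whose first edge has direction `b`. -/
def ContainsAllAntipaths {V : Type*} (D : V → V → Prop) (k : ℕ) : Prop :=
  ∀ b : Bool, ∃ f g, IsAntipath D k f g ∧ g 0 = b

/-- `f` describes an antidirected cycle of length `n` in `D`: the `i`-th edge joins
`f i` and `f (i+1)` and is directed from `f i` iff `g i = true`; every vertex `f i`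
has out-degree `0` on the cycle (i.e. `g i = false ∧ g (i-1) = true`) or in-degree `0`
on the cycle (i.e. `g i = true ∧ g (i-1) = false`). -/
def IsAnticycle {V : Type*} (D : V → V → Prop) (n : ℕ) [NeZero n] (f : ZMod n → V) : Prop :=
  3 ≤ n ∧ Function.Injective f ∧
  ∃ g : ZMod n → Bool,
    (∀ i, if g i then D (f i) (f (i + 1)) else D (f (i + 1)) (f i)) ∧
    (∀ i : ZMod n, (g i = false ∧ g (i - 1) = true) ∨ (g i = true ∧ g (i - 1) = false))

/-- `f 0, ..., f m` is an antidirected path whose even-indexed vertices are its sources. -/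
def IsSourcePath {V : Type*} (D : V → V → Prop) (m : ℕ) (f : ℕ → V) : Prop :=
  Set.InjOn f (Set.Iic m) ∧
    ∀ i < m, (Even i → D (f i) (f (i + 1))) ∧ (¬ Even i → D (f (i + 1)) (f i))

/-- The sequence obtained from `f` by reversing its first `2 * a + 1` entries. -/
def rotate {V : Type*} (a : ℕ) (f : ℕ → V) (j : ℕ) : V :=
  if j ≤ 2 * a then f (2 * a - j) else f j

section

variable {V : Type*} {D : V → V → Prop} {m : ℕ} {f : ℕ → V}

theorem IsSourcePath.isAntipath (h : IsSourcePath D m f) :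
    IsAntipath D m f (fun i => decide (Even i)) := by
  refine ⟨h.1, fun i hi => ?_, fun i _ => ?_⟩
  · by_cases he : Even i
    · simpa [he] using (h.2 i hi).1 he
    · simpa [he] using (h.2 i hi).2 he
  · by_cases he : Even i <;> simp [he, Nat.even_add_one]

theorem IsSourcePath.isAntipath_of_flip (h : IsSourcePath (flip D) m f) :
    IsAntipath D m f (fun i => decide (¬ Even i)) := by
  refine ⟨h.1, fun i hi => ?_, fun i _ => ?_⟩
  · by_cases he : Even i
    · simpa [he, flip] using (h.2 i hi).1 he
    · simpa [he, flip] using (h.2 i hi).2 he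
  · by_cases he : Even i <;> simp [he, Nat.even_add_one]

theorem IsAntipath.isSourcePath_or_flip {g : ℕ → Bool} (h : IsAntipath D m f g) :
    IsSourcePath D m f ∨ IsSourcePath (flip D) m f := by
  obtain ⟨hinj, he, ha⟩ := h
  have key : ∀ i < m, (g i = g 0 ↔ Even i) := by
    intro i
    induction i with
    | zero => simp
    | succ i ih =>
      intro hi
      have h1 := ih (by omega)
      have h2 := ha i hi
      rw [Nat.even_add_one, ← h1]
      revert h2
      cases g i <;> cases g (i + 1) <;> cases g 0 <;> simp
  cases h0 : g 0 with
  | true =>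
    refine Or.inl ⟨hinj, fun i hi => ?_⟩
    have h1 := he i hi
    have h2 := key i hi
    rw [h0] at h2
    rw [← h2]
    revert h1
    cases g i <;> simp
  | false =>
    refine Or.inr ⟨hinj, fun i hi => ?_⟩
    have h1 := he i hi
    have h2 := key i hi
    rw [h0] at h2
    rw [← h2]
    revert h1
    cases g i <;> simp [flip]

theorem IsSourcePath.reverse_of_even (h : IsSourcePath D m f) (hm : Even m) :
    IsSourcePath D m (fun i => f (m - i)) := by
  refine ⟨fun i hi j hj hij => ?_, fun i hi => ?_⟩
  · simp only [Set.mem_Iic] at hi hj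
    have := h.1 (by simp : m - i ∈ Set.Iic m) (by simp : m - j ∈ Set.Iic m) hij
    omega
  · have h1 := h.2 (m - (i + 1)) (by omega)
    rw [show m - (i + 1) + 1 = m - i by omega] at h1
    have h2 : Even (m - (i + 1)) ↔ ¬ Even i := by
      simp only [Nat.even_iff] at hm ⊢
      omega
    exact ⟨fun he => h1.2 (by tauto), fun he => h1.1 (by tauto)⟩

theorem IsSourcePath.reverse_of_flip (h : IsSourcePath (flip D) m f) (hm : Odd m) :
    IsSourcePath D m (fun i => f (m - i)) := by
  refine ⟨fun i hi j hj hij => ?_, fun i hi => ?_⟩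
  · simp only [Set.mem_Iic] at hi hj
    have := h.1 (by simp : m - i ∈ Set.Iic m) (by simp : m - j ∈ Set.Iic m) hij
    omega
  · have h1 := h.2 (m - (i + 1)) (by omega)
    rw [show m - (i + 1) + 1 = m - i by omega] at h1
    have h2 : Even (m - (i + 1)) ↔ Even i := by
      simp only [Nat.even_iff, Nat.odd_iff] at hm ⊢
      omega
    exact ⟨fun he => h1.1 (by tauto), fun he => h1.2 (by tauto)⟩

theorem IsSourcePath.rotate (h : IsSourcePath D m f) {a : ℕ} (ha : 2 * a + 1 ≤ m)
    (hD : D (f 0) (f (2 * a + 1))) : IsSourcePath D m (rotate a f) := by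
  refine ⟨fun i hi j hj hij => ?_, fun i hi => ?_⟩
  · simp only [Set.mem_Iic] at hi hj
    unfold _root_.rotate at hij
    split_ifs at hij
    all_goals
      have := h.1 (by simp only [Set.mem_Iic]; omega) (by simp only [Set.mem_Iic]; omega) hij
      omega
  · unfold _root_.rotate
    rcases lt_trichotomy i (2 * a) with hlt | rfl | hgt
    · rw [if_pos (by omega), if_pos (by omega)]
      have h1 := h.2 (2 * a - (i + 1)) (by omega)
      rw [show 2 * a - (i + 1) + 1 = 2 * a - i by omega] at h1
      have h2 : Even (2 * a - (i + 1)) ↔ ¬ Even i := by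
        simp only [Nat.even_iff]
        omega
      exact ⟨fun he => h1.2 (by tauto), fun he => h1.1 (by tauto)⟩
    · rw [if_pos le_rfl, if_neg (by omega)]
      simpa using hD
    · rw [if_neg (by omega), if_neg (by omega)]
      exact h.2 i hi

theorem IsSourcePath.exists_eq_of_edge_from_start (h : IsSourcePath D m f)
    (hmax : ∀ f', ¬ IsSourcePath (flip D) (m + 1) f') {w : V} (hw : D (f 0) w) :
    ∃ i ≤ m, f i = w := by
  by_contra! hne
  refine hmax (fun i => Nat.casesOn i w f) ⟨?_, ?_⟩
  · rintro (_ | i) hi (_ | j) hj hij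
    · rfl
    · exact absurd hij.symm (hne j (by simpa using hj))
    · exact absurd hij (hne i (by simpa using hi))
    · rw [h.1 (by simpa using hi) (by simpa using hj) hij]
  · rintro (_ | i) hi
    · simpa [flip] using hw
    · have := h.2 i (by omega)
      simp only [Nat.even_add_one, flip]
      tauto

theorem IsSourcePath.exists_eq_of_edge_to_end (h : IsSourcePath D m f) (hm : Odd m)
    (hmax : ∀ f', ¬ IsSourcePath D (m + 1) f') {w : V} (hw : D w (f m)) :
    ∃ i ≤ m, f i = w := by
  by_contra! hne
  refine hmax (fun i => if i ≤ m then f i else w) ⟨?_, ?_⟩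
  · intro i hi j hj hij
    simp only [Set.mem_Iic] at hi hj
    dsimp only at hij
    split_ifs at hij with h1 h2 h2
    · exact h.1 h1 h2 hij
    · exact absurd hij (hne i h1)
    · exact absurd hij.symm (hne j h2)
    · omega
  · intro i hi
    dsimp only
    rw [if_pos (by omega)]
    rcases Nat.lt_succ_iff_lt_or_eq.1 hi with h1 | rfl
    · rw [if_pos (by omega)]
      exact h.2 i h1
    · rw [if_neg (by omega)]
      exact ⟨fun he => absurd he (by simpa using hm), fun _ => hw⟩

theorem IsSourcePath.isAnticycle (h : IsSourcePath D m f) (hm : Odd m) (h1m : 1 < m)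
    (hD : D (f 0) (f m)) : IsAnticycle D (m + 1) (fun z => f z.val) := by
  have hval : ∀ z : ZMod (m + 1), z.val < m ∧ (z + 1).val = z.val + 1 ∨
      z.val = m ∧ (z + 1).val = 0 := by
    intro z
    have := z.val_lt
    rw [ZMod.val_add, ZMod.val_one'' (by omega)]
    rcases Nat.lt_succ_iff_lt_or_eq.1 this with h1 | h1
    · exact Or.inl ⟨h1, Nat.mod_eq_of_lt (by omega)⟩
    · exact Or.inr ⟨h1, by rw [h1, Nat.mod_self]⟩
  refine ⟨by omega, fun x y hxy => ?_, fun z => decide (Even z.val), fun z => ?_, fun z => ?_⟩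
  · have hx := x.val_lt
    have hy := y.val_lt
    exact ZMod.val_injective _ (h.1 (by simp only [Set.mem_Iic]; omega)
      (by simp only [Set.mem_Iic]; omega) hxy)
  · rcases hval z with ⟨h1, h2⟩ | ⟨h1, h2⟩
    · simp only [h2]
      by_cases he : Even z.val
      · simpa [he] using (h.2 _ h1).1 he
      · simpa [he] using (h.2 _ h1).2 he
    · simpa [h1, h2, Nat.not_even_iff_odd.2 hm] using hD
  · obtain ⟨y, rfl⟩ : ∃ y, z = y + 1 := ⟨z - 1, by ring⟩
    rw [add_sub_cancel_right]
    rcases hval y with ⟨h1, h2⟩ | ⟨h1, h2⟩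
    · simp only [h2, Nat.even_add_one]
      by_cases he : Even y.val <;> simp [he]
    · simp [h1, h2, Nat.not_even_iff_odd.2 hm]

open Finset

open scoped Classical in
theorem outDeg_le_card_filter {v : V} (h : ∀ w, D v w → ∃ i ≤ m, f i = w) :
    outDeg D v ≤ #{i ∈ range (m + 1) | D v (f i)} := by
  calc outDeg D v ≤ (({i ∈ range (m + 1) | D v (f i)}.image f : Finset V) : Set V).ncard := by
        refine Set.ncard_le_ncard (fun w hw => ?_) (Finset.finite_toSet _)
        obtain ⟨i, hi, rfl⟩ := h w hw
        simp only [coe_image, Set.mem_image, mem_coe, mem_filter, mem_range]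
        exact ⟨i, ⟨by omega, hw⟩, rfl⟩
    _ ≤ _ := by
        rw [Set.ncard_coe_finset]
        exact card_image_le

theorem card_filter_range_two_mul (P : ℕ → Prop) [DecidablePred P] (n : ℕ) :
    #{i ∈ range (2 * n) | P i} = #{a ∈ range n | P (2 * a)} + #{a ∈ range n | P (2 * a + 1)} := by
  simp only [card_filter]
  induction n with
  | zero => simp
  | succ n ih =>
    rw [show 2 * (n + 1) = 2 * n + 1 + 1 by ring]
    simp only [sum_range_succ, ih]
    ring

open scoped Classical in
theorem IsOriented.exists_two_mul_card_lt (hor : IsOriented D) {S : Finset V} (hS : S.Nonempty) :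
    ∃ s ∈ S, 2 * #{t ∈ S | D s t} + 1 ≤ #S := by
  by_contra! hlt
  have hsum : ∑ s ∈ S, #{t ∈ S | D s t} = ∑ s ∈ S, #{t ∈ S | D t s} :=
    sum_card_bipartiteAbove_eq_sum_card_bipartiteBelow D
  have hle : ∀ s ∈ S, #{t ∈ S | D s t} + #{t ∈ S | D t s} + 1 ≤ #S := by
    intro s hs
    rw [← card_union_of_disjoint]
    · refine card_lt_card ⟨fun t ht => ?_, fun hsub => ?_⟩
      · simp only [mem_union, mem_filter] at ht
        tauto
      · have := hsub hs
        simp only [mem_union, mem_filter] at this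
        have := hor s s
        tauto
    · rw [disjoint_filter]
      intro t _ h1 h2
      exact hor _ _ h1 h2
  have h1 := sum_le_sum hle
  have h2 := sum_lt_sum_of_nonempty hS hlt
  simp only [sum_add_distrib, ← mul_sum] at h1 h2
  omega

open scoped Classical in
/-- For odd `m`, the two ends of a longest antidirected path close up, after a rotation. -/
theorem IsSourcePath.exists_isAnticycle (h : IsSourcePath D m f) (hor : IsOriented D)
    (hm : Odd m) (h1m : 1 < m)
    (hout : ∀ v w, D v w → 3 * m + 1 ≤ 4 * outDeg D v)
    (hin : ∀ v w, D w v → 3 * m + 1 ≤ 4 * inDeg D v)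
    (hmax : ∀ f', ¬ IsSourcePath D (m + 1) f')
    (hmax_flip : ∀ f', ¬ IsSourcePath (flip D) (m + 1) f') :
    ∃ c : ZMod (m + 1) → V, IsAnticycle D (m + 1) c := by
  obtain ⟨n, rfl⟩ := hm
  have hirr : ∀ v, ¬ D v v := fun v hv => hor v v hv hv
  have hstart := hout (f 0) (f 1) ((h.2 0 (by omega)).1 (by simp))
  have hend := hin (f (2 * n + 1)) (f (2 * n)) ((h.2 (2 * n) (by omega)).1 (by simp))
  have hstart_le := outDeg_le_card_filter (D := D) (m := 2 * n + 1) (f := f) (v := f 0)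
    fun w hw => h.exists_eq_of_edge_from_start hmax_flip hw
  have hend_le : inDeg D (f (2 * n + 1)) ≤
      #{i ∈ range (2 * n + 1 + 1) | D (f i) (f (2 * n + 1))} :=
    outDeg_le_card_filter (D := flip D) (m := 2 * n + 1) (f := f) (v := f (2 * n + 1)) fun w hw => h.exists_eq_of_edge_to_end ⟨n, rfl⟩ hmax hw
  rw [show 2 * n + 1 + 1 = 2 * (n + 1) by ring, card_filter_range_two_mul] at hstart_le hend_le
  have hstart_even : #{a ∈ range (n + 1) | D (f 0) (f (2 * a))} ≤ n := by
    refine (card_le_card (t := (range (n + 1)).erase 0) fun a ha => ?_).trans (by simp)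
    rw [mem_filter] at ha
    refine mem_erase.2 ⟨?_, ha.1⟩
    rintro rfl
    exact hirr _ ha.2
  have hend_odd : #{a ∈ range (n + 1) | D (f (2 * a + 1)) (f (2 * n + 1))} ≤ n := by
    refine (card_le_card (t := (range (n + 1)).erase n) fun a ha => ?_).trans (by simp)
    rw [mem_filter] at ha
    refine mem_erase.2 ⟨?_, ha.1⟩
    rintro rfl
    exact hirr _ ha.2
  obtain ⟨a, ha⟩ : ({a ∈ range (n + 1) | D (f 0) (f (2 * a + 1))} ∩
      {a ∈ range (n + 1) | D (f (2 * a)) (f (2 * n + 1))}).Nonempty := by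
    apply inter_nonempty_of_card_lt_card_add_card (s := range (n + 1))
      (filter_subset _ _) (filter_subset _ _)
    rw [card_range]
    omega
  simp only [mem_inter, mem_filter, mem_range] at ha
  refine ⟨_, (h.rotate (by omega) ha.1.2).isAnticycle ⟨n, rfl⟩ h1m ?_⟩
  unfold _root_.rotate
  rw [if_pos (by omega), if_neg (by omega)]
  exact ha.2.2

open scoped Classical in
/-- A longest antidirected path cannot have even length: the vertices at which a path with the
same sources can start would outnumber the sources. -/
theorem IsSourcePath.not_even [Fintype V] (h : IsSourcePath D m f) (hor : IsOriented D)
    (h1m : 1 < m) (hout : ∀ v w, D v w → 3 * m + 1 ≤ 4 * outDeg D v)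
    (hmax_flip : ∀ f', ¬ IsSourcePath (flip D) (m + 1) f') : ¬ Even m := by
  rintro ⟨n, hn⟩
  obtain rfl : m = 2 * n := by omega
  set A : Finset V := (range (n + 1)).image fun a => f (2 * a)
  have hA : #A ≤ n + 1 := card_image_le.trans (by simp)
  set S : Finset V := {s | ∃ p, IsSourcePath D (2 * n) p ∧ (∀ a ≤ n, p (2 * a) ∈ A) ∧ p 0 = s}
  have hmemS : ∀ s, s ∈ S ↔
      ∃ p, IsSourcePath D (2 * n) p ∧ (∀ a ≤ n, p (2 * a) ∈ A) ∧ p 0 = s := by simp [S]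
  have hSA : S ⊆ A := by
    intro s hs
    obtain ⟨p, -, hpA, rfl⟩ := (hmemS s).1 hs
    exact hpA 0 (by omega)
  have hS : S.Nonempty := ⟨f 0, (hmemS _).2
    ⟨f, h, fun a ha => mem_image_of_mem _ (by simp; omega), rfl⟩⟩
  obtain ⟨s, hs, hdeg⟩ := hor.exists_two_mul_card_lt hS
  obtain ⟨p, hp, hpA, rfl⟩ := (hmemS s).1 hs
  have hinj : ∀ i ≤ 2 * n, ∀ j ≤ 2 * n, p i = p j → i = j := fun i hi j hj => hp.1 hi hj
  have hlow := hout _ _ ((hp.2 0 (by omega)).1 (by simp))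
  have hup := outDeg_le_card_filter (D := D) (m := 2 * n) (f := p) (v := p 0)
    fun w hw => hp.exists_eq_of_edge_from_start hmax_flip hw
  have hsplit : #{i ∈ range (2 * n + 1) | D (p 0) (p i)} =
      #{a ∈ range (n + 1) | D (p 0) (p (2 * a))} +
        #{a ∈ range n | D (p 0) (p (2 * a + 1))} := by
    have := card_filter_range_two_mul (fun i => D (p 0) (p i)) n
    simp only [card_filter, sum_range_succ] at this ⊢
    omega
  have hodd : #{a ∈ range n | D (p 0) (p (2 * a + 1))} + 1 ≤ #S := by
    have hlast : p (2 * n) ∈ S := (hmemS _).2 ⟨_, hp.reverse_of_even ⟨n, hn⟩, fun a ha => by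
      simpa only [← Nat.mul_sub] using hpA (n - a) (by omega), rfl⟩
    rw [← card_erase_add_one hlast]
    refine Nat.add_le_add_right (card_le_card_of_injOn (fun a => p (2 * a)) ?_ ?_) 1
    · intro a ha
      simp only [coe_filter, mem_range, Set.mem_ofPred_eq] at ha
      refine mem_erase.2 ⟨fun he => ?_, (hmemS _).2
        ⟨_, hp.rotate (by omega) ha.2, fun b hb => ?_, by simp [_root_.rotate]⟩⟩
      · have := hinj _ (by omega) _ (by omega) he
        omega
      · unfold _root_.rotate
        split_ifs
        · rw [← Nat.mul_sub]
          exact hpA _ (by omega)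
        · exact hpA _ hb
    · intro a ha b hb hab
      simp only [coe_filter, mem_range, Set.mem_ofPred_eq] at ha hb
      have := hinj _ (by omega) _ (by omega) hab
      omega
  have heven : #{a ∈ range (n + 1) | D (p 0) (p (2 * a))} ≤
      #{t ∈ S | D (p 0) t} + #(A \ S) := by
    refine (card_le_card_of_injOn (t := {t ∈ S | D (p 0) t} ∪ A \ S)
      (fun a => p (2 * a)) ?_ ?_).trans (card_union_le _ _)
    · intro a ha
      simp only [coe_filter, mem_range, Set.mem_ofPred_eq] at ha
      have := hpA a (by omega)
      simp only [coe_union, coe_filter, coe_sdiff, Set.mem_union, Set.mem_ofPred_eq, Set.mem_sdiff,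
        mem_coe]
      tauto
    · intro a ha b hb hab
      simp only [coe_filter, mem_range, Set.mem_ofPred_eq] at ha hb
      have := hinj _ (by omega) _ (by omega) hab
      omega
  have hcard := card_sdiff_add_card_eq_card hSA
  omega

end

/-- Lemma 2: if `D` is an oriented graph of minimum pseudo-semidegree at least `(3k-2)/4`
and the maximum length `m` of an antidirected path in `D` satisfies `1 < m < k`, then `D`
contains an antidirected cycle of length `m + 1`. -/
theorem stmt_5 {V : Type*} [Fintype V] (D : V → V → Prop) (hor : IsOriented D)
    (k m : ℕ) (hps : PseudoGE D ((3 * (k : ℝ) - 2) / 4))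
    (hpath : ∃ f g, IsAntipath D m f g)
    (hlongest : ∀ m' f g, IsAntipath D m' f g → m' ≤ m)
    (h1m : 1 < m) (hmk : m < k) :
    ∃ f : ZMod (m + 1) → V, IsAnticycle D (m + 1) f := by
  have hdeg : ∀ d : ℕ, d ≠ 0 → (d = 0 ∨ (3 * (k : ℝ) - 2) / 4 ≤ (d : ℝ)) → 3 * m + 1 ≤ 4 * d := by
    intro d h0 h
    have h1 := h.resolve_left h0
    have h2 : (3 * k : ℝ) ≤ 4 * d + 2 := by linarith
    have h3 : 3 * k ≤ 4 * d + 2 := by exact_mod_cast h2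
    omega
  have hout : ∀ v w, D v w → 3 * m + 1 ≤ 4 * outDeg D v := fun v w hvw =>
    hdeg _ ((Set.ncard_pos (Set.toFinite _)).2 ⟨w, hvw⟩).ne' (hps.2 v).1
  have hin : ∀ v w, D w v → 3 * m + 1 ≤ 4 * inDeg D v := fun v w hvw =>
    hdeg _ ((Set.ncard_pos (Set.toFinite _)).2 ⟨w, hvw⟩).ne' (hps.2 v).2
  have hmax : ∀ f', ¬ IsSourcePath D (m + 1) f' := fun f' h' => by
    have := hlongest _ _ _ h'.isAntipath
    omega
  have hmax_flip : ∀ f', ¬ IsSourcePath (flip D) (m + 1) f' := fun f' h' => by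
    have := hlongest _ _ _ h'.isAntipath_of_flip
    omega
  obtain ⟨f, g, hfg⟩ := hpath
  rcases hfg.isSourcePath_or_flip with h | h
  · have hm := Nat.not_even_iff_odd.1 (h.not_even hor h1m hout hmax_flip)
    exact h.exists_isAnticycle hor hm h1m hout hin hmax hmax_flip
  · have hm := Nat.not_even_iff_odd.1
      (h.not_even (fun u v huv hvu => hor u v hvu huv) h1m hin hmax)
    exact (h.reverse_of_flip hm).exists_isAnticycle hor hm h1m hout hin hmax hmax_flip
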